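/- Let f : ℝ → ℝ be continuously differentiable on an open interval (a,b), let T be an n×n complex Hermitian matrix with spectral decomposition T = U Diag(t₁,…,tₙ) U* where all tᵢ ∈ (a,b), and let H be an n×n complex Hermitian matrix. Then the matrix-valued function α ↦ F(T + αH) is differentiable at α = 0 with derivative U (T_f ⊙ (U* H U)) U*, where T_f is the n×n matrix with entries [T_f]_{ij} = f^{[1]}(tᵢ, tⱼ) and ⊙ is the Hadamard product. -/

import Mathlib

open Matrix

attribute [local instance] Matrix.normedAddCommGroup Matrix.normedSpace

/-- The matrix extension `F` of `f : ℝ → ℝ`: for Hermitian `A = U Diag(λ) U*`,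
`F(A) := U Diag(f(λᵢ)) U*` (junk value `0` if `A` is not Hermitian). -/
noncomputable def matExt {𝕜 : Type*} [RCLike 𝕜] {n : Type*} [Fintype n] [DecidableEq n]
    (f : ℝ → ℝ) (A : Matrix n n 𝕜) : Matrix n n 𝕜 :=
  if hA : A.IsHermitian then
    (hA.eigenvectorUnitary : Matrix n n 𝕜) *
      Matrix.diagonal (fun i => (f (hA.eigenvalues i) : 𝕜)) *
      star (hA.eigenvectorUnitary : Matrix n n 𝕜)
  else 0

/-- The first divided difference of `f`: `(f x − f y)/(x − y)` for `x ≠ y`, and `f'(x)`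
on the diagonal. -/
noncomputable def divDiff (f : ℝ → ℝ) (x y : ℝ) : ℝ :=
  if x = y then deriv f x else (f x - f y) / (x - y)

open Filter Topology

section DividedDifference

lemma divDiff_eq_dslope (f : ℝ → ℝ) (x y : ℝ) : divDiff f x y = dslope f x y := by
  unfold divDiff
  split_ifs with h
  · subst h; simp
  · rw [dslope_of_ne _ (Ne.symm h), slope_def_field, ← neg_sub (f y), ← neg_sub y, neg_div_neg_eq]

lemma continuousAt_divDiff {f : ℝ → ℝ} {x y : ℝ} (hx : DifferentiableAt ℝ f x)
    (hy : ContinuousAt f y) : ContinuousAt (divDiff f x) y := by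
  rw [show divDiff f x = dslope f x from funext (divDiff_eq_dslope f x)]
  rcases eq_or_ne y x with rfl | h
  · exact continuousAt_dslope_same.2 hx
  · exact (continuousAt_dslope_of_ne h).2 hy

lemma divDiff_mul_sub (f : ℝ → ℝ) (x y : ℝ) : divDiff f x y * (y - x) = f y - f x := by
  rw [divDiff_eq_dslope, mul_comm]
  exact sub_smul_dslope f x y

end DividedDifference

/-- If the weights `w k` concentrate where `μ` is close to `s k`, then `g ∘ μ` may be replaced by
`g (s k)` against the weight `w k`, for `g` continuous at the points `s k`. -/
lemma tendsto_sub_mul_weight_zero {ι κ : Type*} [Fintype κ] {l : Filter ι} {g : ℝ → ℝ}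
    {s : κ → ℝ} (hg : ∀ k, ContinuousAt g (s k)) {μ : ι → ℝ} {w : ι → κ → ℂ}
    (hw : ∀ x, ∑ k, ‖w x k‖ ^ 2 = 1)
    (h : ∀ k, Tendsto (fun x => ((μ x - s k : ℝ) : ℂ) * w x k) l (𝓝 0)) (k : κ) :
    Tendsto (fun x => ((g (μ x) - g (s k) : ℝ) : ℂ) * w x k) l (𝓝 0) := by
  have hle : ∀ x m, ‖w x m‖ ≤ 1 := fun x m => by
    have := Finset.single_le_sum (f := fun k => ‖w x k‖ ^ 2) (fun _ _ => sq_nonneg _)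
      (Finset.mem_univ m)
    simp only [hw] at this
    exact (sq_le_one_iff₀ (norm_nonneg _)).1 this
  rw [tendsto_iff_ultrafilter]
  intro F hF
  have hF' := fun m => (h m).mono_left hF
  obtain ⟨m, c, hc, hm⟩ : ∃ m, ∃ c : ℝ, 0 < c ∧ ∀ᶠ x in (F : Filter ι), c ≤ ‖w x m‖ := by
    by_contra! hcon
    have h0 : ∀ m, Tendsto (fun x => ‖w x m‖) (F : Filter ι) (𝓝 0) := by
      intro m
      rw [tendsto_order]
      refine ⟨fun a ha => .of_forall fun x => ha.trans_le (norm_nonneg _), hcon m⟩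
    have h1 := tendsto_finsetSum Finset.univ fun m _ => (h0 m).pow 2
    simp only [hw] at h1
    have := tendsto_nhds_unique h1 tendsto_const_nhds
    simp at this
  have hμ : Tendsto μ F (𝓝 (s m)) := by
    rw [tendsto_iff_norm_sub_tendsto_zero]
    have h1 : Tendsto (fun x => c⁻¹ * ‖((μ x - s m : ℝ) : ℂ) * w x m‖) F (𝓝 0) := by
      simpa using (hF' m).norm.const_mul c⁻¹
    refine squeeze_zero' (.of_forall fun _ => norm_nonneg _) ?_ h1
    filter_upwards [hm] with x hx
    rw [norm_mul, Complex.norm_real, le_inv_mul_iff₀ hc, mul_comm]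
    gcongr
  have hgμ : Tendsto (fun x => ((g (μ x) - g (s k) : ℝ) : ℂ)) F (𝓝 ((g (s m) - g (s k) : ℝ) : ℂ)) :=
    (Complex.continuous_ofReal.tendsto _).comp (((hg m).tendsto.comp hμ).sub_const _)
  rcases eq_or_ne (s m) (s k) with e | e
  · rw [e, sub_self, Complex.ofReal_zero] at hgμ
    refine squeeze_zero_norm (fun x => ?_) (by simpa only [norm_zero] using hgμ.norm)
    rw [norm_mul]
    exact mul_le_of_le_one_right (norm_nonneg _) (hle x k)
  · have hsub : Tendsto (fun x => ((μ x - s k : ℝ) : ℂ)) F (𝓝 ((s m - s k : ℝ) : ℂ)) :=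
      (Complex.continuous_ofReal.tendsto _).comp (hμ.sub_const _)
    have hne : ((s m - s k : ℝ) : ℂ) ≠ 0 := by exact_mod_cast sub_ne_zero.2 e
    have hwk : Tendsto (fun x => w x k) F (𝓝 0) := by
      have := (hF' k).div hsub hne
      rw [zero_div] at this
      refine this.congr' ?_
      filter_upwards [hsub.eventually_ne hne] with x hx
      simp only [Pi.div_apply]
      field_simp
    simpa using hgμ.mul hwk

/-- Entrywise derivative of `f` applied to `Diag(t) + αK`, given spectral decompositions
`W α Diag(μ α) (W α)*` of the perturbed matrices. -/
lemma hasDerivAt_conj_diagonal_apply {n : Type*} [Fintype n] [DecidableEq n] {f : ℝ → ℝ}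
    {t : n → ℝ} (hf : ∀ i, DifferentiableAt ℝ f (t i)) {K : Matrix n n ℂ}
    {W : ℝ → Matrix n n ℂ} {μ : ℝ → n → ℝ} (hW : ∀ α, W α ∈ Matrix.unitaryGroup n ℂ)
    (hK : ∀ α : ℝ, Matrix.diagonal (fun i => (t i : ℂ)) + (α : ℂ) • K =
      W α * Matrix.diagonal (fun i => (μ α i : ℂ)) * (W α)ᴴ) (i k : n) :
    HasDerivAt (fun α => (W α * Matrix.diagonal (fun i => (f (μ α i) : ℂ)) * (W α)ᴴ) i k)
      ((divDiff f (t i) (t k) : ℂ) * K i k) 0 := by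
  have hWW : ∀ α, W α * (W α)ᴴ = 1 := fun α => Matrix.mem_unitaryGroup_iff.1 (hW α)
  have hWW' : ∀ α, (W α)ᴴ * W α = 1 := fun α => Matrix.mem_unitaryGroup_iff'.1 (hW α)
  have hcomm : ∀ α i j, ((μ α j - t i : ℝ) : ℂ) * W α i j = (α : ℂ) * (K * W α) i j := by
    intro α i j
    have h := congrArg (fun M => (M * W α) i j) (hK α)
    simp only [Matrix.mul_assoc, hWW', Matrix.mul_one, Matrix.add_mul, Matrix.smul_mul,
      Matrix.add_apply, Matrix.smul_apply, Matrix.diagonal_mul, Matrix.mul_diagonal,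
      smul_eq_mul] at h
    push_cast
    linear_combination -h
  have hKW : ∀ i j, ∃ C, ∀ α, ‖(K * W α) i j‖ ≤ C := fun i j => by
    refine ⟨∑ l, ‖K i l‖, fun α => ?_⟩
    rw [Matrix.mul_apply]
    refine (norm_sum_le _ _).trans (Finset.sum_le_sum fun l _ => ?_)
    rw [norm_mul]
    exact mul_le_of_le_one_right (norm_nonneg _) (entry_norm_bound_of_unitary (hW α) l j)
  have hα : Tendsto (fun α : ℝ => (α : ℂ)) (𝓝 0) (𝓝 0) := by
    simpa using Complex.continuous_ofReal.tendsto 0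
  have hconc : ∀ j k, Tendsto (fun α => ((μ α j - t k : ℝ) : ℂ) * W α k j) (𝓝 0) (𝓝 0) := by
    intro j k
    obtain ⟨C, hC⟩ := hKW k j
    simp only [hcomm]
    refine squeeze_zero_norm (a := fun α : ℝ => ‖(α : ℂ)‖ * C) (fun α => ?_)
      (by simpa using hα.norm.mul_const C)
    rw [norm_mul]
    gcongr
    exact hC α
  have hcol : ∀ j α, ∑ k, ‖W α k j‖ ^ 2 = 1 := by
    intro j α
    have h := congrArg (fun M => M j j) (hWW' α)
    simp only [Matrix.mul_apply, Matrix.conjTranspose_apply, Matrix.one_apply_eq,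
      RCLike.star_def, Complex.conj_mul'] at h
    exact_mod_cast h
  have hlim : ∀ j, Tendsto (fun α => (K * W α) i j *
      star (((divDiff f (t i) (μ α j) - divDiff f (t i) (t k) : ℝ) : ℂ) * W α k j))
      (𝓝 0) (𝓝 0) := by
    intro j
    obtain ⟨C, hC⟩ := hKW i j
    have h := (tendsto_sub_mul_weight_zero
      (fun k => continuousAt_divDiff (hf i) (hf k).continuousAt)
      (hcol j) (hconc j) k).norm.const_mul C
    rw [norm_zero, mul_zero] at h
    refine squeeze_zero_norm (fun α => ?_) h
    rw [norm_mul, norm_star]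
    exact mul_le_mul_of_nonneg_right (hC α) (norm_nonneg _)
  have hunit : ∀ α i, ∑ j, W α i j * star (W α k j) = (1 : Matrix n n ℂ) i k := by
    intro α i
    rw [← hWW α, Matrix.mul_apply]
    rfl
  set h : ℝ → ℂ := fun α =>
    ∑ j, (divDiff f (t i) (μ α j) : ℂ) * (K * W α) i j * star (W α k j) with h_def
  have hexp : ∀ α, (W α * Matrix.diagonal (fun i => (f (μ α i) : ℂ)) * (W α)ᴴ) i k =
      (f (t i) : ℂ) * (1 : Matrix n n ℂ) i k + (α : ℂ) * h α := by
    intro α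
    rw [← hunit α i, Finset.mul_sum, h_def, Finset.mul_sum, ← Finset.sum_add_distrib,
      Matrix.mul_apply]
    refine Finset.sum_congr rfl fun j _ => ?_
    rw [Matrix.mul_diagonal, Matrix.conjTranspose_apply]
    have h1 := hcomm α i j
    have h2 : (divDiff f (t i) (μ α j) : ℂ) * ((μ α j - t i : ℝ) : ℂ) = f (μ α j) - f (t i) := by
      exact_mod_cast divDiff_mul_sub f (t i) (μ α j)
    linear_combination (-(W α i j * star (W α k j))) * h2 +
      (divDiff f (t i) (μ α j) : ℂ) * star (W α k j) * h1
  have hh : Tendsto h (𝓝 0) (𝓝 ((divDiff f (t i) (t k) : ℂ) * K i k)) := by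
    have hsum := (tendsto_finsetSum Finset.univ fun j _ => hlim j).add_const
      ((divDiff f (t i) (t k) : ℂ) * K i k)
    simp only [Finset.sum_const_zero, zero_add] at hsum
    refine hsum.congr fun α => ?_
    have hKik : K i k = ∑ j, (K * W α) i j * star (W α k j) := by
      conv_lhs => rw [← Matrix.mul_one K, ← hWW α, ← Matrix.mul_assoc, Matrix.mul_apply]
      rfl
    rw [hKik, Finset.mul_sum, ← Finset.sum_add_distrib]
    refine Finset.sum_congr rfl fun j _ => ?_
    simp only [star_mul', RCLike.star_def, Complex.conj_ofReal]
    push_cast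
    ring
  rw [hasDerivAt_iff_tendsto_slope]
  refine (hh.mono_left nhdsWithin_le_nhds).congr' ?_
  filter_upwards [self_mem_nhdsWithin] with α hα0
  have hα0 : (α : ℂ) ≠ 0 := by exact_mod_cast hα0
  rw [slope_def_module, hexp, hexp, Complex.real_smul]
  push_cast
  field_simp
  simp

lemma exists_matExt_eq {n : Type*} [Fintype n] [DecidableEq n] (f : ℝ → ℝ) {A : Matrix n n ℂ}
    (hA : A.IsHermitian) : ∃ V ∈ Matrix.unitaryGroup n ℂ, ∃ μ : n → ℝ,
      A = V * Matrix.diagonal (fun i => (μ i : ℂ)) * Vᴴ ∧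
      matExt f A = V * Matrix.diagonal (fun i => (f (μ i) : ℂ)) * Vᴴ := by
  refine ⟨hA.eigenvectorUnitary, hA.eigenvectorUnitary.2, hA.eigenvalues, ?_, ?_⟩
  · have h := hA.spectral_theorem
    rw [Unitary.conjStarAlgAut_apply] at h
    exact h
  · rw [matExt, dif_pos hA]
    rfl

/-- For Hermitian `T = U Diag(t₁,…,tₙ) U*` with `U` unitary and `tᵢ ∈ (a,b)`, `f` a `C¹`
function on `(a,b)`, and `H` Hermitian, the map `α ↦ F(T + αH)` is differentiable at `0`
with derivative `U (T_f ⊙ (U* H U)) U*`, where `[T_f]_{ij} = f^{[1]}(tᵢ,tⱼ)`. -/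
theorem matExt_hasDerivAt {n : ℕ} (a b : ℝ) (f : ℝ → ℝ)
    (hf : ContDiffOn ℝ 1 f (Set.Ioo a b))
    (t : Fin n → ℝ) (ht : ∀ i, t i ∈ Set.Ioo a b)
    (U T : Matrix (Fin n) (Fin n) ℂ) (hU : U ∈ Matrix.unitaryGroup (Fin n) ℂ)
    (hT : T = U * Matrix.diagonal (fun i => (t i : ℂ)) * Uᴴ)
    (H : Matrix (Fin n) (Fin n) ℂ) (hH : H.IsHermitian) :
    HasDerivAt (fun α : ℝ => matExt f (T + (α : ℂ) • H))
      (U * Matrix.hadamard (Matrix.of fun i j => (divDiff f (t i) (t j) : ℂ))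
        (Uᴴ * H * U) * Uᴴ) 0 := by
  have hUU : U * Uᴴ = 1 := Matrix.mem_unitaryGroup_iff.1 hU
  have hUU' : Uᴴ * U = 1 := Matrix.mem_unitaryGroup_iff'.1 hU
  have hd : ∀ i, DifferentiableAt ℝ f (t i) := fun i =>
    (hf.differentiableOn one_ne_zero).differentiableAt (isOpen_Ioo.mem_nhds (ht i))
  have hTH : T.IsHermitian := by
    rw [hT]
    exact Matrix.isHermitian_mul_mul_conjTranspose U
      (Matrix.isHermitian_diagonal_of_self_adjoint _ (by ext i; simp))
  have hX : ∀ α : ℝ, (T + (α : ℂ) • H).IsHermitian := fun α =>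
    hTH.add (by simp [Matrix.IsHermitian, Matrix.conjTranspose_smul, hH.eq])
  choose V hV μ hdec hext using fun α => exists_matExt_eq f (hX α)
  have hderiv := hasDerivAt_conj_diagonal_apply hd (K := Uᴴ * H * U) (W := fun α => Uᴴ * V α)
    (μ := μ) (fun α => mul_mem (Unitary.star_mem hU) (hV α)) fun α => by
      have h := congrArg (fun M => Uᴴ * M * U) (hdec α)
      simp only [hT, Matrix.mul_add, Matrix.add_mul, Matrix.mul_smul, Matrix.smul_mul] at h
      simp only [Matrix.conjTranspose_mul, Matrix.conjTranspose_conjTranspose]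
      calc _ = (Uᴴ * U) * Matrix.diagonal (fun i => (t i : ℂ)) * (Uᴴ * U) +
            (α : ℂ) • (Uᴴ * H * U) := by rw [hUU', Matrix.one_mul, Matrix.mul_one]
        _ = _ := by simpa only [Matrix.mul_assoc] using h
  have hconj : ∀ α : ℝ, matExt f (T + (α : ℂ) • H) =
      U * ((Uᴴ * V α) * Matrix.diagonal (fun i => (f (μ α i) : ℂ)) * (Uᴴ * V α)ᴴ) * Uᴴ := by
    intro α
    rw [hext, Matrix.conjTranspose_mul, Matrix.conjTranspose_conjTranspose]
    calc _ = (U * Uᴴ) * (V α * Matrix.diagonal (fun i => (f (μ α i) : ℂ)) * (V α)ᴴ) * (U * Uᴴ) := by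
          rw [hUU, Matrix.one_mul, Matrix.mul_one]
      _ = _ := by simp only [Matrix.mul_assoc]
  simp only [hconj]
  refine hasDerivAt_pi.2 fun p => hasDerivAt_pi.2 fun q => ?_
  simp only [Matrix.mul_apply (M := U * _), Matrix.mul_apply (M := U)]
  refine HasDerivAt.fun_sum fun j _ => HasDerivAt.mul_const ?_ _
  exact HasDerivAt.fun_sum fun l _ => (hderiv l j).const_mul _
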